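/- arXiv:1605.04190 — 6 statements merged into one kernel-verified Lean document; each statement's English description precedes it below -/
import Mathlib

section
/- Let U ⊆ ℝⁿ be a connected open set and γ : U → U a C^∞ diffeomorphism of finite order, i.e. γ^m = id_U for some integer m ≥ 1. If γ(u₀) = u₀ for some u₀ ∈ U and the Fréchet derivative of γ at u₀ is the identity map of ℝⁿ, then γ = id_U. -/
open Filter Topology

/-- A map which is periodic near a fixed point `a`, with strict derivative the identity at `a`,
is the identity near `a`: the sum `G` of its iterates over a period satisfies `G ∘ f = G` near `a`
and has an invertible strict derivative at `a`. -/
theorem HasStrictFDerivAt.eventually_eq_self_of_iterate_eq_self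
    {E : Type*} [NormedAddCommGroup E] [NormedSpace ℝ E] {f : E → E} {a : E}
    (hf : HasStrictFDerivAt f (ContinuousLinearMap.id ℝ E) a) (ha : f a = a)
    {m : ℕ} (hm : m ≠ 0) (hper : ∀ᶠ x in 𝓝 a, f^[m] x = x) :
    ∀ᶠ x in 𝓝 a, f x = x := by
  have hsum : HasStrictFDerivAt (fun x => ∑ k ∈ Finset.range m, f^[k] x)
      (∑ k ∈ Finset.range m, ContinuousLinearMap.id ℝ E ^ k) a :=
    HasStrictFDerivAt.fun_sum fun k _ => hf.iterate ha k
  have hder : (∑ k ∈ Finset.range m, ContinuousLinearMap.id ℝ E ^ k)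
      = (m : ℝ) • ContinuousLinearMap.id ℝ E := by
    have h : ∀ k : ℕ, ContinuousLinearMap.id ℝ E ^ k = ContinuousLinearMap.id ℝ E :=
      fun k => one_pow k
    simp [h, Nat.cast_smul_eq_nsmul]
  rw [hder] at hsum
  have hlim : Tendsto (fun x => (x, f x)) (𝓝 a) (𝓝 (a, a)) := by
    have h : ContinuousAt f a := hf.continuousAt
    rw [ContinuousAt, ha] at h
    exact tendsto_id.prodMk_nhds h
  have hm0 : (0 : ℝ) < m := by exact_mod_cast Nat.pos_of_ne_zero hm
  have hbound := (hsum.isLittleO.comp_tendsto hlim).bound (half_pos hm0)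
  filter_upwards [hbound, hper] with x hx hpx
  have hinv : ∑ k ∈ Finset.range m, f^[k] (f x) = ∑ k ∈ Finset.range m, f^[k] x := by
    have h := Finset.sum_range_succ (fun k => f^[k] x) m
    rw [Finset.sum_range_succ'] at h
    simpa [hpx] using h
  simp only [Function.comp_apply, hinv, sub_self, zero_sub, norm_neg,
    smul_apply, ContinuousLinearMap.id_apply, norm_smul,
    Real.norm_natCast] at hx
  have hnorm : ‖x - f x‖ = 0 := by nlinarith [norm_nonneg (x - f x)]
  exact (sub_eq_zero.mp (norm_eq_zero.mp hnorm)).symm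


/-- A finite-order `C^∞` diffeomorphism of a connected open set
`U ⊆ ℝⁿ` fixing a point `u₀ ∈ U` with identity Fréchet derivative at `u₀`
is the identity on `U`. -/
theorem finite_order_diffeo_eq_id_of_fderiv_eq_id
    (n : ℕ) (U : Set (EuclideanSpace ℝ (Fin n)))
    (hUopen : IsOpen U) (hUconn : IsConnected U)
    (γ γinv : EuclideanSpace ℝ (Fin n) → EuclideanSpace ℝ (Fin n))
    -- `γ` is a `C^∞` diffeomorphism of `U`
    (hbij : Set.BijOn γ U U)
    (hsmooth : ContDiffOn ℝ (⊤ : ℕ∞) γ U)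
    (hinvsmooth : ContDiffOn ℝ (⊤ : ℕ∞) γinv U)
    (hinv : Set.InvOn γinv γ U U)
    -- `γ` has finite order: `γ^m = id_U` for some `m ≥ 1`
    (m : ℕ) (hm : 1 ≤ m) (horder : ∀ u ∈ U, γ^[m] u = u)
    -- `γ` fixes `u₀` and its Fréchet derivative there is the identity
    (u₀ : EuclideanSpace ℝ (Fin n)) (hu₀ : u₀ ∈ U)
    (hfix : γ u₀ = u₀)
    (hder : fderiv ℝ γ u₀ = ContinuousLinearMap.id ℝ (EuclideanSpace ℝ (Fin n))) :
    ∀ u ∈ U, γ u = u := by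
  have hat : ∀ u ∈ U, ContDiffAt ℝ (⊤ : ℕ∞) γ u := fun u hu =>
    hsmooth.contDiffAt (hUopen.mem_nhds hu)
  have hlocal : ∀ u ∈ U, γ u = u →
      fderiv ℝ γ u = ContinuousLinearMap.id ℝ (EuclideanSpace ℝ (Fin n)) →
      ∀ᶠ x in 𝓝 u, γ x = x := by
    intro u hu hγu hd
    have hstrict := (hat u hu).hasStrictFDerivAt (by simp)
    rw [hd] at hstrict
    exact hstrict.eventually_eq_self_of_iterate_eq_self hγu (Nat.one_le_iff_ne_zero.mp hm)
      (eventually_of_mem (hUopen.mem_nhds hu) horder)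
  have hsub : U ⊆ {u | ∀ᶠ x in 𝓝 u, γ x = x} := by
    refine hUconn.isPreconnected.subset_of_closure_inter_subset isOpen_setOfPred_eventually_nhds
      ⟨u₀, hu₀, hlocal u₀ hu₀ hfix hder⟩ ?_
    rintro u ⟨hcl, hu⟩
    have hfreq := mem_closure_iff_frequently.mp hcl
    have hcont : ContinuousAt γ u := (hat u hu).continuousAt
    have hcont' : ContinuousAt (fderiv ℝ γ) u :=
      ((hat u hu).fderiv_right (m := 0) (by simp)).continuousAt
    refine hlocal u hu ?_ ?_
    · by_contra hne
      obtain ⟨x, hx, hxne⟩ :=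
        (hfreq.and_eventually ((hcont.ne_iff_eventually_ne continuousAt_id).mp hne)).exists
      exact hxne hx.self_of_nhds
    · by_contra hne
      obtain ⟨x, hx, hxne⟩ := (hfreq.and_eventually (hcont'.eventually_ne hne)).exists
      refine hxne ?_
      have hid : γ =ᶠ[𝓝 x] id := hx
      rw [hid.fderiv_eq, fderiv_id]
  exact fun u hu => (hsub hu).self_of_nhds
end

section
/- Let U ⊆ ℝⁿ be a connected open set and γ : U → U a C^∞ diffeomorphism of finite order, i.e. γ^m = id_U for some integer m ≥ 1. If γ restricts to the identity map on some nonempty open subset of U, then γ = id_U. -/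
open Filter Topology

/-- A continuous-at-`x` function which agrees on `W` with a function continuous at `x` takes the
same value at every point `x` of the closure of `W`. -/
lemma eq_of_mem_closure_of_eqOn {X Y : Type*} [TopologicalSpace X] [TopologicalSpace Y] [T2Space Y]
    {f g : X → Y} {W : Set X} {x : X} (hx : x ∈ closure W) (hf : ContinuousAt f x)
    (hg : ContinuousAt g x) (h : Set.EqOn f g W) : f x = g x := by
  have : (𝓝[W] x).NeBot := mem_closure_iff_nhdsWithin_neBot.mp hx
  refine tendsto_nhds_unique (hf.tendsto.mono_left (nhdsWithin_le_nhds (s := W))) ?_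
  refine (hg.tendsto.mono_left nhdsWithin_le_nhds).congr' ?_
  filter_upwards [self_mem_nhdsWithin] with y hy using (h hy).symm

/-- The sum over an orbit is invariant under the map. -/
lemma sum_iterate_apply_eq_of_iterate_eq {E : Type*} [AddCommGroup E] {f : E → E} {m : ℕ} {y : E}
    (h : f^[m] y = y) :
    ∑ k ∈ Finset.range m, f^[k] (f y) = ∑ k ∈ Finset.range m, f^[k] y := by
  have h1 := Finset.sum_range_succ (fun k => f^[k] y) m
  rw [Finset.sum_range_succ'] at h1
  simpa [h] using h1

/-- A map of finite order near a fixed point, strictly differentiable there with derivative the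
identity, is the identity near that point. -/
lemma HasStrictFDerivAt.eventually_eq_self_of_iterate_eq {E : Type*} [NormedAddCommGroup E]
    [NormedSpace ℝ E] [CompleteSpace E] {f : E → E} {x : E}
    (hf : HasStrictFDerivAt f (ContinuousLinearMap.id ℝ E) x) (hx : f x = x) {m : ℕ} (hm : m ≠ 0)
    (hord : ∀ᶠ y in 𝓝 x, f^[m] y = y) : ∀ᶠ y in 𝓝 x, f y = y := by
  have hsum : HasStrictFDerivAt (fun y => (m : ℝ)⁻¹ • ∑ k ∈ Finset.range m, f^[k] y)
      ((ContinuousLinearEquiv.refl ℝ E : E ≃L[ℝ] E) : E →L[ℝ] E) x := by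
    have h := (HasStrictFDerivAt.fun_sum (u := Finset.range m)
      fun k _ => hf.iterate hx k).const_smul (m : ℝ)⁻¹
    refine h.congr_fderiv ?_
    ext v
    have hm' : (m : ℝ) ≠ 0 := Nat.cast_ne_zero.mpr hm
    have hone : ContinuousLinearMap.id ℝ E = 1 := rfl
    simp [hone, ← Nat.cast_smul_eq_nsmul ℝ, smul_smul, hm']
  have hinv := hsum.eventually_left_inverse
  have htend : Tendsto f (𝓝 x) (𝓝 x) := by simpa [hx] using hf.continuousAt.tendsto
  filter_upwards [hinv, htend.eventually hinv, hord] with y h1 h2 h3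
  rw [sum_iterate_apply_eq_of_iterate_eq h3] at h2
  exact h2.symm.trans h1


/-- A finite-order `C^∞` diffeomorphism of a connected open set
`U ⊆ ℝⁿ` which is the identity on some nonempty open subset of `U`
is the identity on `U`. -/
theorem finite_order_diffeo_eq_id_of_eq_id_on_open
    (n : ℕ) (U : Set (EuclideanSpace ℝ (Fin n)))
    (hUopen : IsOpen U) (hUconn : IsConnected U)
    (γ γinv : EuclideanSpace ℝ (Fin n) → EuclideanSpace ℝ (Fin n))
    -- `γ` is a `C^∞` diffeomorphism of `U`
    (hbij : Set.BijOn γ U U)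
    (hsmooth : ContDiffOn ℝ (⊤ : ℕ∞) γ U)
    (hinvsmooth : ContDiffOn ℝ (⊤ : ℕ∞) γinv U)
    (hinv : Set.InvOn γinv γ U U)
    -- `γ` has finite order: `γ^m = id_U` for some `m ≥ 1`
    (m : ℕ) (hm : 1 ≤ m) (horder : ∀ u ∈ U, γ^[m] u = u)
    -- `γ` is the identity on some nonempty open subset of `U`
    (V : Set (EuclideanSpace ℝ (Fin n)))
    (hVopen : IsOpen V) (hVne : V.Nonempty) (hVU : V ⊆ U)
    (hfix : ∀ u ∈ V, γ u = u) :
    ∀ u ∈ U, γ u = u := by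
  have hsub : U ⊆ interior {y | γ y = y} := by
    have hVW : V ⊆ interior {y | γ y = y} := interior_maximal hfix hVopen
    refine hUconn.isPreconnected.subset_of_closure_inter_subset isOpen_interior
      (hVne.mono fun v hv => ⟨hVU hv, hVW hv⟩) ?_
    rintro x ⟨hxW, hxU⟩
    have hU : U ∈ 𝓝 x := hUopen.mem_nhds hxU
    have hcd : ContDiffAt ℝ (⊤ : ℕ∞) γ x := hsmooth.contDiffAt hU
    have hx : γ x = x := eq_of_mem_closure_of_eqOn hxW hcd.continuousAt continuousAt_id
      fun y hy => (interior_subset hy : y ∈ {y | γ y = y})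
    have hfd : ContinuousAt (fderiv ℝ γ) x :=
      (hsmooth.continuousOn_fderiv_of_isOpen hUopen (by simp)).continuousAt hU
    have hd : fderiv ℝ γ x = ContinuousLinearMap.id ℝ _ := by
      refine eq_of_mem_closure_of_eqOn hxW hfd
        (continuousAt_const (y := ContinuousLinearMap.id ℝ _)) fun y hy => ?_
      have hy' : γ =ᶠ[𝓝 y] id := mem_interior_iff_mem_nhds.mp hy
      rw [hy'.fderiv_eq, fderiv_id]
    have hs := hcd.hasStrictFDerivAt (by simp)
    rw [hd] at hs
    exact mem_interior_iff_mem_nhds.mpr <|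
      hs.eventually_eq_self_of_iterate_eq hx (Nat.one_le_iff_ne_zero.mp hm)
        (eventually_of_mem hU horder)
  exact fun u hu => (interior_subset (hsub hu) : u ∈ {y | γ y = y})
end

section
/- Let Γ be a finite group with a smooth and effective action on a connected open set U ⊆ ℝⁿ, and suppose u₀ ∈ U satisfies γ • u₀ = u₀ for every γ ∈ Γ. Then the map Γ → GL(n, ℝ) sending γ to D_{u₀}(γ), the Fréchet derivative at u₀ of the diffeomorphism u ↦ γ • u, is an injective group homomorphism. -/
/-- If a finite-order element `γ` of a smooth action fixes `x` and has identity derivative there,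
then it acts as the identity near `x`: the orbit sum `∑ k < orderOf γ, γ ^ k • y` is
`γ`-invariant and locally injective at `x`. -/
theorem eventually_eq_self_of_fderiv_eq_id
    {E : Type*} [NormedAddCommGroup E] [NormedSpace ℝ E] [CompleteSpace E]
    {Γ : Type*} [Group Γ] {U : Set E} (hU : IsOpen U) {ρ : Γ → E → E}
    (hone : ∀ u ∈ U, ρ 1 u = u)
    (hmul : ∀ γ δ : Γ, ∀ u ∈ U, ρ (γ * δ) u = ρ γ (ρ δ u))
    {γ : Γ} (hγ : IsOfFinOrder γ) {x : E} (hx : x ∈ U) (hfix : ρ γ x = x)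
    (hder : HasStrictFDerivAt (ρ γ) (ContinuousLinearMap.id ℝ E) x) :
    ∀ᶠ y in nhds x, ρ γ y = y := by
  have hUx : ∀ᶠ y in nhds x, y ∈ U := hU.mem_nhds hx
  have hpow : ∀ k : ℕ, ρ (γ ^ k) x = x ∧
      HasStrictFDerivAt (ρ (γ ^ k)) (ContinuousLinearMap.id ℝ E) x := by
    intro k
    induction k with
    | zero =>
      simp only [pow_zero]
      refine ⟨hone x hx, (hasStrictFDerivAt_id x).congr_of_eventuallyEq ?_⟩
      filter_upwards [hUx] with y hy using (hone y hy).symm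
    | succ k ih =>
      obtain ⟨hk, hdk⟩ := ih
      simp only [pow_succ]
      refine ⟨by rw [hmul _ _ x hx, hfix, hk], ?_⟩
      have hcomp : HasStrictFDerivAt (fun y => ρ (γ ^ k) (ρ γ y))
          ((ContinuousLinearMap.id ℝ E).comp (ContinuousLinearMap.id ℝ E)) x :=
        HasStrictFDerivAt.comp x (by rwa [hfix]) hder
      refine HasStrictFDerivAt.congr_of_eventuallyEq hcomp ?_
      filter_upwards [hUx] with y hy using (hmul _ _ y hy).symm
  set m := orderOf γ with hm
  have hm0 : (m : ℝ) ≠ 0 := Nat.cast_ne_zero.mpr hγ.orderOf_pos.ne'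
  let h : E → E := fun y => ∑ k ∈ Finset.range m, ρ (γ ^ k) y
  let e : E ≃L[ℝ] E := ContinuousLinearEquiv.smulLeft (Units.mk0 (m : ℝ) hm0)
  have hh : HasStrictFDerivAt h (e : E →L[ℝ] E) x := by
    have hsum : HasStrictFDerivAt h
        (∑ _k ∈ Finset.range m, ContinuousLinearMap.id ℝ E) x :=
      HasStrictFDerivAt.fun_sum fun k _ => (hpow k).2
    convert hsum using 1
    ext v
    simp [e, Nat.cast_smul_eq_nsmul, Units.smul_def]
  have hinv : ∀ y ∈ U, h (ρ γ y) = h y := by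
    intro y hy
    have hshift : h (ρ γ y) = ∑ k ∈ Finset.range m, ρ (γ ^ (k + 1)) y :=
      Finset.sum_congr rfl fun k _ => by rw [pow_succ, hmul _ _ y hy]
    have hperiod : ρ (γ ^ m) y = ρ (γ ^ 0) y := by rw [hm, pow_orderOf_eq_one, pow_zero]
    have hsucc := Finset.sum_range_succ (fun k => ρ (γ ^ k) y) m
    rw [Finset.sum_range_succ', hperiod] at hsucc
    rw [hshift]
    exact add_right_cancel hsucc
  have hleft := hh.eventually_left_inverse
  have htend : Filter.Tendsto (ρ γ) (nhds x) (nhds x) := by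
    simpa only [ContinuousAt, hfix] using hder.continuousAt
  filter_upwards [hleft, htend.eventually hleft, hUx] with y hy hγy hyU
  rw [← hγy, hinv y hyU, hy]

/-- For a smooth effective action of a finite group `Γ` on a
connected open set `U ⊆ ℝⁿ` fixing a point `u₀`, the isotropy representation
`γ ↦ D_{u₀}(γ)` is an injective group homomorphism into `GL(n, ℝ)`
(realized as the group of units of continuous linear endomorphisms of `ℝⁿ`). -/
theorem isotropy_representation_injective
    (n : ℕ) (Γ : Type*) [Group Γ] [Finite Γ]
    (U : Set (EuclideanSpace ℝ (Fin n)))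
    (hUopen : IsOpen U) (hUconn : IsConnected U)
    (ρ : Γ → EuclideanSpace ℝ (Fin n) → EuclideanSpace ℝ (Fin n))
    -- `ρ` is a smooth action of `Γ` on `U`
    (hmaps : ∀ γ : Γ, Set.MapsTo (ρ γ) U U)
    (hsmooth : ∀ γ : Γ, ContDiffOn ℝ (⊤ : ℕ∞) (ρ γ) U)
    (hone : ∀ u ∈ U, ρ 1 u = u)
    (hmul : ∀ γ δ : Γ, ∀ u ∈ U, ρ (γ * δ) u = ρ γ (ρ δ u))
    -- the action is effective
    (heff : ∀ γ : Γ, (∀ u ∈ U, ρ γ u = u) → γ = 1)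
    -- `u₀ ∈ U` is fixed by every element of `Γ`
    (u₀ : EuclideanSpace ℝ (Fin n)) (hu₀ : u₀ ∈ U)
    (hfix : ∀ γ : Γ, ρ γ u₀ = u₀) :
    ∃ D : Γ →* (EuclideanSpace ℝ (Fin n) →L[ℝ] EuclideanSpace ℝ (Fin n))ˣ,
      Function.Injective D ∧
      ∀ γ : Γ, (D γ : EuclideanSpace ℝ (Fin n) →L[ℝ] EuclideanSpace ℝ (Fin n))
        = fderiv ℝ (ρ γ) u₀ := by
  have hC : ∀ γ : Γ, ∀ u ∈ U, ContDiffAt ℝ (⊤ : ℕ∞) (ρ γ) u := fun γ u hu =>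
    (hsmooth γ).contDiffAt (hUopen.mem_nhds hu)
  have hdiff : ∀ γ : Γ, DifferentiableAt ℝ (ρ γ) u₀ := fun γ =>
    (hC γ u₀ hu₀).differentiableAt (by simp)
  have hU₀ : ∀ᶠ y in nhds u₀, y ∈ U := hUopen.mem_nhds hu₀
  let D : Γ →* (EuclideanSpace ℝ (Fin n) →L[ℝ] EuclideanSpace ℝ (Fin n)) :=
    { toFun := fun γ => fderiv ℝ (ρ γ) u₀
      map_one' := by
        have hid : ρ 1 =ᶠ[nhds u₀] id := by
          filter_upwards [hU₀] with y hy using hone y hy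
        rw [hid.fderiv_eq, fderiv_id]
        rfl
      map_mul' := fun γ δ => by
        have hcomp : ρ (γ * δ) =ᶠ[nhds u₀] ρ γ ∘ ρ δ := by
          filter_upwards [hU₀] with y hy using hmul γ δ y hy
        rw [hcomp.fderiv_eq, fderiv_comp u₀ (by rw [hfix]; exact hdiff γ) (hdiff δ), hfix]
        rfl }
  refine ⟨D.toHomUnits, (injective_iff_map_eq_one _).mpr fun γ hγ => heff γ ?_, fun _ => rfl⟩
  have hD : fderiv ℝ (ρ γ) u₀ = ContinuousLinearMap.id ℝ _ := congrArg Units.val hγ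
  have hlocal : ∀ x ∈ U, ρ γ x = x → fderiv ℝ (ρ γ) x = ContinuousLinearMap.id ℝ _ →
      ∀ᶠ y in nhds x, ρ γ y = y := fun x hx hfx hdx =>
    eventually_eq_self_of_fderiv_eq_id hUopen hone hmul (isOfFinOrder_of_finite γ) hx hfx
      (hdx ▸ (hC γ x hx).hasStrictFDerivAt (by simp))
  let S : Set (EuclideanSpace ℝ (Fin n)) := {x | ∀ᶠ y in nhds x, ρ γ y = y}
  have hS : IsOpen S := isOpen_setOfPred_eventually_nhds
  have hsub : U ⊆ S := by
    refine hUconn.isPreconnected.subset_of_closure_inter_subset hS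
      ⟨u₀, hu₀, hlocal u₀ hu₀ (hfix γ) hD⟩ ?_
    rintro x ⟨hxS, hxU⟩
    have hfreq : ∃ᶠ y in nhds x, y ∈ S := mem_closure_iff_frequently.mp hxS
    refine hlocal x hxU ?_ ?_
    · refine tendsto_nhds_unique_of_frequently_eq (hC γ x hxU).continuousAt
        continuousAt_id (hfreq.mono fun y hy => hy.self_of_nhds)
    · have hcont : ContinuousAt (fderiv ℝ (ρ γ)) x :=
        ((hC γ x hxU).fderiv_right (m := 0) (by simp)).continuousAt
      refine tendsto_nhds_unique_of_frequently_eq hcont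
        continuousAt_const (hfreq.mono fun y hy => ?_)
      have hid : ρ γ =ᶠ[nhds y] id := hy
      rw [hid.fderiv_eq, fderiv_id]
  exact fun u hu => (hsub hu).self_of_nhds
end

section
/- Let Γ be a finite group with a smooth and effective action on a connected open set U ⊆ ℝⁿ. Then the induced action of Γ on U × GL(n, ℝ) defined by γ • (u, p) = (γ • u, D_u(γ) ∘ p) is a group action which is free, i.e. the stabilizer of every point of U × GL(n, ℝ) is trivial. -/
open Filter Topology

/-- A map of finite order near a fixed point `x`, tangent to the identity at `x`, is the identity
near `x`: the sum of its iterates is invariant under the map and locally injective at `x`. -/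
theorem HasStrictFDerivAt.eventually_eq_self_of_iterate {E : Type*} [NormedAddCommGroup E]
    [NormedSpace ℝ E] {f : E → E} {x : E} {m : ℕ} (hm : m ≠ 0)
    (hf : HasStrictFDerivAt f (ContinuousLinearMap.id ℝ E) x) (hx : f x = x)
    (hiter : ∀ᶠ y in 𝓝 x, f^[m] y = y) : ∀ᶠ y in 𝓝 x, f y = y := by
  have hsum : HasStrictFDerivAt (fun y => ∑ k ∈ Finset.range m, f^[k] y)
      (∑ k ∈ Finset.range m, ContinuousLinearMap.id ℝ E ^ k) x :=
    HasStrictFDerivAt.fun_sum fun k _ => hf.iterate hx k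
  have hder : ∑ k ∈ Finset.range m, ContinuousLinearMap.id ℝ E ^ k
      = (m : ℝ) • ContinuousLinearMap.id ℝ E := by
    have hid : ContinuousLinearMap.id ℝ E = 1 := rfl
    simp [hid, Nat.cast_smul_eq_nsmul]
  rw [hder] at hsum
  have hpair : Tendsto (fun y => (f y, y)) (𝓝 x) (𝓝 (x, x)) := by
    have hcont : Tendsto f (𝓝 x) (𝓝 x) := by
      simpa only [hx] using hf.continuousAt.tendsto
    exact hcont.prodMk_nhds tendsto_id
  have hbound := hpair.eventually (hsum.isLittleO.def (one_half_pos (α := ℝ)))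
  filter_upwards [hbound, hiter] with y hy hmy
  have hinv : ∑ k ∈ Finset.range m, f^[k] (f y) = ∑ k ∈ Finset.range m, f^[k] y := by
    have h := (Finset.sum_range_succ' (fun k => f^[k] y) m).symm.trans
      (Finset.sum_range_succ (fun k => f^[k] y) m)
    rw [hmy] at h
    exact add_right_cancel h
  simp only [hinv, sub_self, zero_sub, norm_neg, smul_apply,
    ContinuousLinearMap.id_apply, norm_smul, Real.norm_natCast] at hy
  have hm1 : (1 : ℝ) ≤ m := by exact_mod_cast Nat.one_le_iff_ne_zero.mpr hm
  have hnorm : ‖f y - y‖ ≤ 0 := by nlinarith [norm_nonneg (f y - y)]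
  exact sub_eq_zero.mp (norm_le_zero_iff.mp hnorm)

/-- A `C¹` self-map of finite order of a preconnected open set, fixing a point and tangent to the
identity there, is the identity. -/
theorem IsPreconnected.eqOn_id_of_iterate_of_fderiv_eq_id {E : Type*} [NormedAddCommGroup E]
    [NormedSpace ℝ E] {U : Set E} (hU : IsPreconnected U) (hUo : IsOpen U) {f : E → E} {m : ℕ}
    (hm : m ≠ 0) (hf : ContDiffOn ℝ 1 f U) (hiter : ∀ y ∈ U, f^[m] y = y) {x : E} (hxU : x ∈ U)
    (hx : f x = x) (hdx : fderiv ℝ f x = ContinuousLinearMap.id ℝ E) : Set.EqOn f id U := by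
  have hlocal : ∀ y ∈ U, f y = y → fderiv ℝ f y = ContinuousLinearMap.id ℝ E →
      ∀ᶠ z in 𝓝 y, f z = z := by
    intro y hy hfy hdy
    have hstrict := (hf.contDiffAt (hUo.mem_nhds hy)).hasStrictFDerivAt one_ne_zero
    rw [hdy] at hstrict
    exact hstrict.eventually_eq_self_of_iterate hm hfy
      (Filter.mem_of_superset (hUo.mem_nhds hy) hiter)
  have hsub : U ⊆ {y | ∀ᶠ z in 𝓝 y, f z = z} := by
    refine hU.subset_of_closure_inter_subset isOpen_setOfPred_eventually_nhds
      ⟨x, hxU, hlocal x hxU hx hdx⟩ ?_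
    rintro y ⟨hyc, hyU⟩
    have hyn := hUo.mem_nhds hyU
    have hcont : ContinuousAt (fun z => (f z, fderiv ℝ f z)) y :=
      (hf.continuousOn.continuousAt hyn).prodMk
        ((hf.continuousOn_fderiv_of_isOpen hUo le_rfl).continuousAt hyn)
    have hlim : Tendsto (fun z => (f z, fderiv ℝ f z))
        (𝓝[{y | ∀ᶠ z in 𝓝 y, f z = z}] y) (𝓝 (y, ContinuousLinearMap.id ℝ E)) := by
      refine Tendsto.congr' (f₁ := fun z => (z, ContinuousLinearMap.id ℝ E)) ?_
        (tendsto_nhdsWithin_of_tendsto_nhds (tendsto_id.prodMk_nhds tendsto_const_nhds))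
      filter_upwards [self_mem_nhdsWithin] with z hz
      have hzid : f =ᶠ[𝓝 z] id := hz
      rw [hzid.fderiv_eq, fderiv_id, hzid.eq_of_nhds, id]
    have : (𝓝[{y | ∀ᶠ z in 𝓝 y, f z = z}] y).NeBot := mem_closure_iff_nhdsWithin_neBot.mp hyc
    have heq := tendsto_nhds_unique (hcont.tendsto.mono_left nhdsWithin_le_nhds) hlim
    exact hlocal y hyU (congrArg Prod.fst heq) (congrArg Prod.snd heq)
  exact fun y hy => (hsub hy).self_of_nhds


/-- For a smooth effective action of a finite group `Γ` on a
connected open set `U ⊆ ℝⁿ`, the induced action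
`γ • (u, p) = (γ • u, D_u(γ) ∘ p)` on the frame bundle `U × GL(n, ℝ)`
(with `GL(n, ℝ)` realized as the units of continuous linear endomorphisms
of `ℝⁿ`) is a group action, and it is free: every stabilizer is trivial. -/
theorem frame_bundle_action_free
    (n : ℕ) (Γ : Type*) [Group Γ] [Finite Γ]
    (U : Set (EuclideanSpace ℝ (Fin n)))
    (hUopen : IsOpen U) (hUconn : IsConnected U)
    (ρ : Γ → EuclideanSpace ℝ (Fin n) → EuclideanSpace ℝ (Fin n))
    -- `ρ` is a smooth action of `Γ` on `U`
    (hmaps : ∀ γ : Γ, Set.MapsTo (ρ γ) U U)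
    (hsmooth : ∀ γ : Γ, ContDiffOn ℝ (⊤ : ℕ∞) (ρ γ) U)
    (hone : ∀ u ∈ U, ρ 1 u = u)
    (hmul : ∀ γ δ : Γ, ∀ u ∈ U, ρ (γ * δ) u = ρ γ (ρ δ u))
    -- the action is effective
    (heff : ∀ γ : Γ, (∀ u ∈ U, ρ γ u = u) → γ = 1) :
    -- the induced maps on `U × GL(n, ℝ)` form a group action:
    -- the identity acts as the identity ...
    (∀ u ∈ U, ∀ p : (EuclideanSpace ℝ (Fin n) →L[ℝ] EuclideanSpace ℝ (Fin n))ˣ,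
      (ρ 1 u, (fderiv ℝ (ρ 1) u).comp
        (p : EuclideanSpace ℝ (Fin n) →L[ℝ] EuclideanSpace ℝ (Fin n))) = (u, ↑p)) ∧
    -- ... and the action is compatible with multiplication ...
    (∀ γ δ : Γ, ∀ u ∈ U,
      ∀ p : (EuclideanSpace ℝ (Fin n) →L[ℝ] EuclideanSpace ℝ (Fin n))ˣ,
      (ρ (γ * δ) u, (fderiv ℝ (ρ (γ * δ)) u).comp
          (p : EuclideanSpace ℝ (Fin n) →L[ℝ] EuclideanSpace ℝ (Fin n)))
        = (ρ γ (ρ δ u), (fderiv ℝ (ρ γ) (ρ δ u)).comp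
            ((fderiv ℝ (ρ δ) u).comp
              (p : EuclideanSpace ℝ (Fin n) →L[ℝ] EuclideanSpace ℝ (Fin n))))) ∧
    -- ... which is free: every stabilizer is trivial
    (∀ γ : Γ, ∀ u ∈ U,
      ∀ p : (EuclideanSpace ℝ (Fin n) →L[ℝ] EuclideanSpace ℝ (Fin n))ˣ,
      ρ γ u = u →
      (fderiv ℝ (ρ γ) u).comp
          (p : EuclideanSpace ℝ (Fin n) →L[ℝ] EuclideanSpace ℝ (Fin n))
        = (p : EuclideanSpace ℝ (Fin n) →L[ℝ] EuclideanSpace ℝ (Fin n)) →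
      γ = 1) := by
  have hdiff : ∀ γ : Γ, ∀ u ∈ U, DifferentiableAt ℝ (ρ γ) u := fun γ u hu =>
    ((hsmooth γ).contDiffAt (hUopen.mem_nhds hu)).differentiableAt (by simp)
  refine ⟨fun u hu p => ?_, fun γ δ u hu p => ?_, fun γ u hu p hfix hder => ?_⟩
  · have hid : ρ 1 =ᶠ[𝓝 u] id := mem_of_superset (hUopen.mem_nhds hu) hone
    rw [hid.fderiv_eq, fderiv_id, ContinuousLinearMap.id_comp, hone u hu]
  · have hcomp : ρ (γ * δ) =ᶠ[𝓝 u] ρ γ ∘ ρ δ :=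
      mem_of_superset (hUopen.mem_nhds hu) (hmul γ δ)
    rw [hcomp.fderiv_eq, fderiv_comp u (hdiff γ _ (hmaps δ hu)) (hdiff δ u hu),
      ContinuousLinearMap.comp_assoc, hmul γ δ u hu]
  · have hid : fderiv ℝ (ρ γ) u = ContinuousLinearMap.id ℝ _ :=
      p.isUnit.mul_right_cancel (hder.trans (one_mul _).symm)
    have hpow : ∀ k : ℕ, ∀ y ∈ U, (ρ γ)^[k] y = ρ (γ ^ k) y := by
      intro k
      induction k with
      | zero => intro y hy; simp [hone y hy]
      | succ k ih => intro y hy; rw [Function.iterate_succ_apply', ih y hy, pow_succ', hmul _ _ y hy]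
    refine heff γ (hUconn.isPreconnected.eqOn_id_of_iterate_of_fderiv_eq_id hUopen
      (m := Nat.card Γ) Nat.card_pos.ne' ((hsmooth γ).of_le (by norm_cast))
      (fun y hy => ?_) hu hfix hid)
    rw [hpow _ y hy, pow_card_eq_one', hone y hy]
end

section
/- Let Γ and Δ be finite groups with smooth and effective actions on connected open sets U ⊆ ℝⁿ and V ⊆ ℝⁿ respectively, and let λ : U → V be a C^∞ map which is a diffeomorphism onto an open subset of V, such that for all u, u' ∈ U one has (∃ γ ∈ Γ, u' = γ • u) if and only if (∃ δ ∈ Δ, λ(u') = δ • λ(u)). Then there exists a group homomorphism α : Γ → Δ such that λ(γ • u) = α(γ) • λ(u) for all γ ∈ Γ and all u ∈ U, i.e. λ is α-equivariant. -/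
open Filter Topology Set

section

variable {E F : Type*} [NormedAddCommGroup E] [NormedSpace ℝ E]
  [NormedAddCommGroup F] [NormedSpace ℝ F]

/-- A germ of finite order with identity derivative at a fixed point is the identity. -/
theorem HasStrictFDerivAt.eventually_eq_self_of_iterate_eq_self_s5 {f : E → E} {p : E} {N : ℕ}
    (hf : HasStrictFDerivAt f (ContinuousLinearMap.id ℝ E) p) (hp : f p = p) (hN : 0 < N)
    (hiter : ∀ᶠ x in 𝓝 p, f^[N] x = x) : ∀ᶠ x in 𝓝 p, f x = x := by
  have hsum : HasStrictFDerivAt (fun x => ∑ k ∈ Finset.range N, f^[k] x)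
      (∑ _k ∈ Finset.range N, ContinuousLinearMap.id ℝ E) p := by
    refine HasStrictFDerivAt.fun_sum fun k _ => ?_
    simpa only [← ContinuousLinearMap.one_def, one_pow] using hf.iterate hp k
  have hpair : Tendsto (fun x => (f x, x)) (𝓝 p) (𝓝 (p, p)) := by
    have := hf.continuousAt.prodMk continuousAt_id
    simpa only [ContinuousAt, id, hp] using this
  filter_upwards [hpair.eventually (hsum.isLittleO.def (c := 1 / 2) (by norm_num)), hiter]
    with x hx hxN
  have hinv : ∑ k ∈ Finset.range N, f^[k] (f x) = ∑ k ∈ Finset.range N, f^[k] x := by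
    have h := (Finset.sum_range_succ' (fun k => f^[k] x) N).symm.trans
      (Finset.sum_range_succ (fun k => f^[k] x) N)
    rw [hxN] at h
    exact add_right_cancel h
  have hN1 : (1 : ℝ) ≤ N := by exact_mod_cast hN
  rw [hinv, sub_self, zero_sub, norm_neg, Finset.sum_const, Finset.card_range,
    smul_apply, ContinuousLinearMap.id_apply,
    ← Nat.cast_smul_eq_nsmul ℝ, norm_smul, Real.norm_natCast] at hx
  have h0 : ‖f x - x‖ = 0 := by nlinarith [norm_nonneg (f x - x)]
  exact sub_eq_zero.1 (norm_eq_zero.1 h0)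

/-- Two `C¹` maps have the same 1-jet at every limit of points near which they coincide. -/
theorem ContDiffAt.eq_and_fderiv_eq_of_mem_closure {f g : E → F} {x : E}
    (hf : ContDiffAt ℝ 1 f x) (hg : ContDiffAt ℝ 1 g x)
    (hx : x ∈ closure {y | f =ᶠ[𝓝 y] g}) : f x = g x ∧ fderiv ℝ f x = fderiv ℝ g x := by
  rw [mem_closure_iff_frequently] at hx
  exact ⟨tendsto_nhds_unique_of_frequently_eq hf.continuousAt hg.continuousAt
      (hx.mono fun y hy => hy.eq_of_nhds),
    tendsto_nhds_unique_of_frequently_eq (hf.continuousAt_fderiv one_ne_zero)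
      (hg.continuousAt_fderiv one_ne_zero) (hx.mono fun y hy => hy.fderiv_eq)⟩

/-- A finite order `C¹` map of a connected open set which agrees to first order with the
identity at one point is the identity. -/
theorem eqOn_id_of_iterate_eq_of_fderiv_eq_id {V : Set E} {f : E → E} {p : E} {N : ℕ}
    (hV : IsOpen V) (hVc : IsPreconnected V) (hf : ContDiffOn ℝ 1 f V) (hN : 0 < N)
    (hiter : ∀ x ∈ V, f^[N] x = x) (hpV : p ∈ V) (hp : f p = p)
    (hp' : fderiv ℝ f p = ContinuousLinearMap.id ℝ E) : ∀ x ∈ V, f x = x := by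
  have hlocal : ∀ x ∈ V, f x = x → fderiv ℝ f x = ContinuousLinearMap.id ℝ E →
      f =ᶠ[𝓝 x] id := by
    intro x hxV hx hx'
    have hs := (hf.contDiffAt (hV.mem_nhds hxV)).hasStrictFDerivAt one_ne_zero
    rw [hx'] at hs
    exact hs.eventually_eq_self_of_iterate_eq_self_s5 hx hN
      (eventually_of_mem (hV.mem_nhds hxV) hiter)
  have hsub : V ⊆ {x | f =ᶠ[𝓝 x] id} := by
    refine hVc.subset_of_closure_inter_subset isOpen_setOfPred_eventually_nhds
      ⟨p, hpV, hlocal p hpV hp hp'⟩ ?_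
    rintro x ⟨hx, hxV⟩
    obtain ⟨h0, h1⟩ := (hf.contDiffAt (hV.mem_nhds hxV)).eq_and_fderiv_eq_of_mem_closure
      contDiffAt_id hx
    exact hlocal x hxV h0 (h1.trans fderiv_id)
  exact fun x hx => (hsub hx).eq_of_nhds

/-- Elements of a finite group acting effectively by `C¹` maps on a connected open set are
determined by their 1-jet at any point. -/
theorem eq_of_fderiv_eq_of_effective {Δ : Type*} [Group Δ] [Finite Δ] {V : Set E}
    {σ : Δ → E → E} (hV : IsOpen V) (hVc : IsPreconnected V)
    (hmaps : ∀ δ, MapsTo (σ δ) V V) (hsmooth : ∀ δ, ContDiffOn ℝ 1 (σ δ) V)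
    (hone : ∀ v ∈ V, σ 1 v = v)
    (hmul : ∀ δ δ' : Δ, ∀ v ∈ V, σ (δ * δ') v = σ δ (σ δ' v))
    (heff : ∀ δ : Δ, (∀ v ∈ V, σ δ v = v) → δ = 1)
    {δ δ' : Δ} {p : E} (hp : p ∈ V) (h0 : σ δ p = σ δ' p)
    (h1 : fderiv ℝ (σ δ) p = fderiv ℝ (σ δ') p) : δ = δ' := by
  have hdiff : ∀ ε : Δ, ∀ v ∈ V, DifferentiableAt ℝ (σ ε) v := fun ε v hv =>
    ((hsmooth ε).contDiffAt (hV.mem_nhds hv)).differentiableAt one_ne_zero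
  have hfd : ∀ ε ε' : Δ,
      fderiv ℝ (σ (ε * ε')) p = (fderiv ℝ (σ ε) (σ ε' p)).comp (fderiv ℝ (σ ε') p) := by
    intro ε ε'
    rw [← fderiv_comp p (hdiff ε _ (hmaps ε' hp)) (hdiff ε' p hp)]
    have heq : σ (ε * ε') =ᶠ[𝓝 p] σ ε ∘ σ ε' :=
      eventually_of_mem (hV.mem_nhds hp) (hmul ε ε')
    exact heq.fderiv_eq
  have hpow : ∀ (ε : Δ) (k : ℕ), ∀ x ∈ V, (σ ε)^[k] x = σ (ε ^ k) x := by
    intro ε k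
    induction k with
    | zero => intro x hx; simp [hone x hx]
    | succ k ih =>
      intro x hx
      rw [Function.iterate_succ_apply, ih _ (hmaps ε hx), pow_succ, hmul _ _ x hx]
  have hε : δ⁻¹ * δ' = 1 := by
    refine heff _ (eqOn_id_of_iterate_eq_of_fderiv_eq_id hV hVc (hsmooth _)
      (orderOf_pos (δ⁻¹ * δ')) (fun x hx => ?_) hp ?_ ?_)
    · rw [hpow _ _ x hx, pow_orderOf_eq_one, hone x hx]
    · rw [hmul _ _ p hp, ← h0, ← hmul _ _ p hp, inv_mul_cancel, hone p hp]
    · rw [hfd, ← h0, ← h1, ← hfd, inv_mul_cancel]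
      have heq : σ 1 =ᶠ[𝓝 p] id := eventually_of_mem (hV.mem_nhds hp) hone
      exact heq.fderiv_eq.trans fderiv_id
  exact inv_mul_eq_one.1 hε

/-- If finitely many `C¹` maps on a connected open set have pairwise distinct 1-jets at every
point, a `C¹` map which pointwise takes one of their values is one of them. -/
theorem exists_eqOn_of_forall_exists_eq {ι : Type*} [Finite ι] [CompleteSpace E] {U : Set E}
    (hU : IsOpen U) (hUc : IsConnected U) {f : E → F} {g : ι → E → F}
    (hf : ContDiffOn ℝ 1 f U) (hg : ∀ i, ContDiffOn ℝ 1 (g i) U)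
    (hjet : ∀ i j, ∀ u ∈ U, g i u = g j u → fderiv ℝ (g i) u = fderiv ℝ (g j) u → i = j)
    (hex : ∀ u ∈ U, ∃ i, f u = g i u) : ∃ i, EqOn f (g i) U := by
  let B : ι → Set U := fun i => {u | f u = g i u ∧ fderiv ℝ f u = fderiv ℝ (g i) u}
  have hcont : ∀ h : E → F, ContDiffOn ℝ 1 h U → Continuous fun u : U => h u :=
    fun h hh => continuousOn_iff_continuous_domRestrict.1 hh.continuousOn
  have hcont' : ∀ h : E → F, ContDiffOn ℝ 1 h U → Continuous fun u : U => fderiv ℝ h u :=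
    fun h hh => continuousOn_iff_continuous_domRestrict.1
      (hh.continuousOn_fderiv_of_isOpen hU le_rfl)
  have hBclosed : ∀ i, IsClosed (B i) := fun i =>
    (isClosed_eq (hcont f hf) (hcont _ (hg i))).inter
      (isClosed_eq (hcont' f hf) (hcont' _ (hg i)))
  have : BaireSpace U := hU.baireSpace
  have hdense : Dense (⋃ i, interior {u : U | f u = g i u}) :=
    dense_iUnion_interior_of_closed (fun i => isClosed_eq (hcont f hf) (hcont _ (hg i)))
      (eq_univ_of_forall fun u => mem_iUnion.2 (hex u u.2))
  have hint : ∀ i, interior {u : U | f u = g i u} ⊆ B i := by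
    intro i u hu
    have hev : f =ᶠ[𝓝 (u : E)] g i := by
      rw [← hU.isOpenEmbedding_subtypeVal.map_nhds_eq u]
      exact mem_interior_iff_mem_nhds.1 hu
    exact ⟨hev.eq_of_nhds, hev.fderiv_eq⟩
  have hcover : ⋃ i, B i = univ := by
    rw [← (isClosed_iUnion_of_finite hBclosed).closure_eq]
    exact (hdense.mono (iUnion_mono hint)).closure_eq
  have : ConnectedSpace U := Subtype.connectedSpace hUc
  obtain ⟨u₀⟩ : Nonempty U := inferInstance
  obtain ⟨i, hi⟩ := mem_iUnion.1 (hcover ▸ mem_univ u₀)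
  have hcompl : (B i)ᶜ = ⋃ j : {j // j ≠ i}, B j := by
    ext u
    constructor
    · intro hu
      obtain ⟨j, hj⟩ := mem_iUnion.1 (hcover ▸ mem_univ u)
      exact mem_iUnion.2 ⟨⟨j, fun hji => hu (hji ▸ hj)⟩, hj⟩
    · intro hu hui
      obtain ⟨⟨j, hji⟩, hj⟩ := mem_iUnion.1 hu
      exact hji (hjet j i u u.2 (hj.1.symm.trans hui.1) (hj.2.symm.trans hui.2))
  have hopen : IsOpen (B i) := by
    rw [← isClosed_compl_iff, hcompl]
    exact isClosed_iUnion_of_finite fun j => hBclosed j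
  have huniv : B i = univ := IsClopen.eq_univ ⟨hBclosed i, hopen⟩ ⟨u₀, hi⟩
  exact ⟨i, fun u hu => (huniv ▸ mem_univ (⟨u, hu⟩ : U) : (⟨u, hu⟩ : U) ∈ B i).1⟩

end


/-- An embedding `λ` of orbifold charts (a `C^∞` diffeomorphism
onto an open subset mapping `Γ`-orbits exactly onto the traces of `Δ`-orbits)
is equivariant with respect to some group homomorphism `α : Γ → Δ`. -/
theorem chart_embedding_equivariant
    (n : ℕ) (Γ Δ : Type*) [Group Γ] [Finite Γ] [Group Δ] [Finite Δ]
    (U V : Set (EuclideanSpace ℝ (Fin n)))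
    (hUopen : IsOpen U) (hUconn : IsConnected U)
    (hVopen : IsOpen V) (hVconn : IsConnected V)
    (ρ : Γ → EuclideanSpace ℝ (Fin n) → EuclideanSpace ℝ (Fin n))
    (σ : Δ → EuclideanSpace ℝ (Fin n) → EuclideanSpace ℝ (Fin n))
    -- `ρ` is a smooth effective action of `Γ` on `U`
    (hρmaps : ∀ γ : Γ, Set.MapsTo (ρ γ) U U)
    (hρsmooth : ∀ γ : Γ, ContDiffOn ℝ (⊤ : ℕ∞) (ρ γ) U)
    (hρone : ∀ u ∈ U, ρ 1 u = u)
    (hρmul : ∀ γ δ : Γ, ∀ u ∈ U, ρ (γ * δ) u = ρ γ (ρ δ u))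
    (hρeff : ∀ γ : Γ, (∀ u ∈ U, ρ γ u = u) → γ = 1)
    -- `σ` is a smooth effective action of `Δ` on `V`
    (hσmaps : ∀ δ : Δ, Set.MapsTo (σ δ) V V)
    (hσsmooth : ∀ δ : Δ, ContDiffOn ℝ (⊤ : ℕ∞) (σ δ) V)
    (hσone : ∀ v ∈ V, σ 1 v = v)
    (hσmul : ∀ δ δ' : Δ, ∀ v ∈ V, σ (δ * δ') v = σ δ (σ δ' v))
    (hσeff : ∀ δ : Δ, (∀ v ∈ V, σ δ v = v) → δ = 1)
    -- `lam : U → V` is a `C^∞` diffeomorphism onto an open subset of `V`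
    (lam laminv : EuclideanSpace ℝ (Fin n) → EuclideanSpace ℝ (Fin n))
    (hlammaps : Set.MapsTo lam U V)
    (hlaminj : Set.InjOn lam U)
    (hlamopen : IsOpen (lam '' U))
    (hlamsmooth : ContDiffOn ℝ (⊤ : ℕ∞) lam U)
    (hlaminvsmooth : ContDiffOn ℝ (⊤ : ℕ∞) laminv (lam '' U))
    (hlaminv : Set.InvOn laminv lam U (lam '' U))
    -- `lam` maps `Γ`-orbits exactly onto traces of `Δ`-orbits
    (horbits : ∀ u ∈ U, ∀ u' ∈ U,
      (∃ γ : Γ, ρ γ u = u') ↔ (∃ δ : Δ, σ δ (lam u) = lam u')) :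
    ∃ α : Γ →* Δ, ∀ γ : Γ, ∀ u ∈ U, lam (ρ γ u) = σ (α γ) (lam u) := by

  have hle : (1 : WithTop ℕ∞) ≤ ((⊤ : ℕ∞) : WithTop ℕ∞) := by exact_mod_cast le_top
  have hlam1 := hlamsmooth.of_le hle
  have hσ1 := fun δ => (hσsmooth δ).of_le hle
  have hdlam : ∀ u ∈ U, DifferentiableAt ℝ lam u := fun u hu =>
    (hlam1.contDiffAt (hUopen.mem_nhds hu)).differentiableAt one_ne_zero
  have hright : ∀ u ∈ U, (fderiv ℝ lam u).comp (fderiv ℝ laminv (lam u)) =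
      ContinuousLinearMap.id ℝ _ := by
    intro u hu
    have hmem : lam u ∈ lam '' U := mem_image_of_mem lam hu
    have hd : DifferentiableAt ℝ laminv (lam u) :=
      ((hlaminvsmooth.of_le hle).contDiffAt (hlamopen.mem_nhds hmem)).differentiableAt one_ne_zero
    have hu' : laminv (lam u) = u := hlaminv.1 hu
    have hcomp := fderiv_comp (lam u) (hu'.symm ▸ hdlam u hu) hd
    rw [hu'] at hcomp
    rw [← hcomp]
    have heq : lam ∘ laminv =ᶠ[𝓝 (lam u)] id :=
      eventually_of_mem (hlamopen.mem_nhds hmem) hlaminv.2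
    exact heq.fderiv_eq.trans fderiv_id
  have hjet : ∀ δ δ' : Δ, ∀ u ∈ U, (σ δ ∘ lam) u = (σ δ' ∘ lam) u →
      fderiv ℝ (σ δ ∘ lam) u = fderiv ℝ (σ δ' ∘ lam) u → δ = δ' := by
    intro δ δ' u hu h0 h1
    have hdσ : ∀ ε, DifferentiableAt ℝ (σ ε) (lam u) := fun ε =>
      ((hσ1 ε).contDiffAt (hVopen.mem_nhds (hlammaps hu))).differentiableAt one_ne_zero
    refine eq_of_fderiv_eq_of_effective hVopen hVconn.isPreconnected hσmaps hσ1 hσone hσmul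
      hσeff (hlammaps hu) h0 ?_
    rw [fderiv_comp u (hdσ δ) (hdlam u hu), fderiv_comp u (hdσ δ') (hdlam u hu)] at h1
    have h2 := congrArg (fun L => L.comp (fderiv ℝ laminv (lam u))) h1
    simpa only [ContinuousLinearMap.comp_assoc, hright u hu, ContinuousLinearMap.comp_id] using h2
  have hex : ∀ γ : Γ, ∃ δ : Δ, EqOn (lam ∘ ρ γ) (σ δ ∘ lam) U := by
    intro γ
    refine exists_eqOn_of_forall_exists_eq hUopen hUconn
      (hlam1.comp ((hρsmooth γ).of_le hle) (hρmaps γ))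
      (fun δ => (hσ1 δ).comp hlam1 hlammaps) hjet fun u hu => ?_
    obtain ⟨δ, hδ⟩ := (horbits u hu _ (hρmaps γ hu)).1 ⟨γ, rfl⟩
    exact ⟨δ, hδ.symm⟩
  choose α hα using hex
  refine ⟨MonoidHom.mk' α fun γ γ' => ?_, fun γ u hu => hα γ hu⟩
  have heq : EqOn (σ (α (γ * γ')) ∘ lam) (σ (α γ * α γ') ∘ lam) U := by
    intro u hu
    calc σ (α (γ * γ')) (lam u) = lam (ρ (γ * γ') u) := (hα _ hu).symm
      _ = lam (ρ γ (ρ γ' u)) := by rw [hρmul γ γ' u hu]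
      _ = σ (α γ) (lam (ρ γ' u)) := hα γ (hρmaps γ' hu)
      _ = σ (α γ) (σ (α γ') (lam u)) := congrArg (σ (α γ)) (hα γ' hu)
      _ = σ (α γ * α γ') (lam u) := (hσmul _ _ _ (hlammaps hu)).symm
  obtain ⟨u, hu⟩ := hUconn.nonempty
  exact hjet _ _ u hu (heq hu) (heq.eventuallyEq_of_mem (hUopen.mem_nhds hu)).fderiv_eq
end

section
/- Let Γ and Δ be finite groups with smooth and effective actions on connected open sets U ⊆ ℝⁿ and V ⊆ ℝⁿ respectively, and let λ : U → V be a C^∞ map which is a diffeomorphism onto an open subset of V. Then any group homomorphism α : Γ → Δ satisfying λ(γ • u) = α(γ) • λ(u) for all γ ∈ Γ and u ∈ U is injective, and there is at most one such homomorphism: if α and α' both satisfy this equivariance condition, then α = α'. -/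
open Filter Topology in
/-- A `C^1` self-map of finite order of a connected open set which is the identity near some point
is the identity. The average `m⁻¹ • ∑ k < m, f^[k]` is `f`-invariant, and it has invertible
derivative, hence is injective, near every limit of points around which `f` is the identity. -/
theorem IsPreconnected.eqOn_id_of_iterate_eqOn_id {E : Type*} [NormedAddCommGroup E]
    [NormedSpace ℝ E] [CompleteSpace E] {V : Set E} (hVc : IsPreconnected V) (hVo : IsOpen V)
    {f : E → E} (hmaps : Set.MapsTo f V V) (hf : ContDiffOn ℝ 1 f V) {m : ℕ} (hm : m ≠ 0)
    (hiter : Set.EqOn f^[m] id V) {p₀ : E} (hp₀ : p₀ ∈ V) (hfp₀ : f =ᶠ[𝓝 p₀] id) :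
    Set.EqOn f id V := by
  have hm' : (m : ℝ) ≠ 0 := Nat.cast_ne_zero.mpr hm
  set ψ : E → E := fun x => (m : ℝ)⁻¹ • ∑ k ∈ Finset.range m, f^[k] x with hψ
  have hψfix : ∀ x, f x = x → ψ x = x := by
    intro x hx
    simp [hψ, Function.iterate_fixed hx, ← Nat.cast_smul_eq_nsmul ℝ, smul_smul, hm']
  have hψinv : ∀ x ∈ V, ψ (f x) = ψ x := by
    intro x hx
    have h1 := Finset.sum_range_succ (fun k => f^[k] x) m
    rw [Finset.sum_range_succ'] at h1
    have h2 : f^[m] x = x := hiter hx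
    simp only [h2, Function.iterate_zero, id_eq, add_left_inj, Function.iterate_succ_apply] at h1
    simp only [hψ, h1]
  have hitd : ∀ k : ℕ, ContDiffOn ℝ 1 f^[k] V := by
    intro k
    induction k with
    | zero => exact contDiffOn_id
    | succ k ih => exact ih.comp hf hmaps
  have hψd : ContDiffOn ℝ 1 ψ V := (ContDiffOn.sum fun k _ => hitd k).const_smul _
  let W : Set E := {x | f =ᶠ[𝓝 x] id}
  have hWo : IsOpen W := isOpen_setOfPred_eventually_nhds
  have hVW : V ⊆ W := by
    refine hVc.subset_of_closure_inter_subset hWo ⟨p₀, hp₀, hfp₀⟩ ?_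
    rintro p ⟨hpW, hpV⟩
    have hVn : V ∈ 𝓝 p := hVo.mem_nhds hpV
    have hfc : ContinuousAt f p := hf.continuousOn.continuousAt hVn
    have hψp : ContDiffAt ℝ 1 ψ p := hψd.contDiffAt hVn
    have : (𝓝[W] p).NeBot := mem_closure_iff_nhdsWithin_neBot.mp hpW
    have hfp : f p = p := by
      refine tendsto_nhds_unique (hfc.tendsto.mono_left (nhdsWithin_le_nhds (s := W))) ?_
      refine (tendsto_id.mono_left nhdsWithin_le_nhds).congr' ?_
      filter_upwards [self_mem_nhdsWithin] with x hx using (Eventually.self_of_nhds hx).symm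
    have hdp : fderiv ℝ ψ p = ContinuousLinearMap.id ℝ E := by
      have hc : ContinuousAt (fderiv ℝ ψ) p := hψp.continuousAt_fderiv one_ne_zero
      refine tendsto_nhds_unique (hc.tendsto.mono_left (nhdsWithin_le_nhds (s := W))) ?_
      refine tendsto_const_nhds.congr' ?_
      filter_upwards [self_mem_nhdsWithin] with x hx
      have hx' : ψ =ᶠ[𝓝 x] id := by
        filter_upwards [hx] with y hy using hψfix y hy
      rw [hx'.fderiv_eq, fderiv_id]
    have hs : HasStrictFDerivAt ψ
        ((ContinuousLinearEquiv.refl ℝ E : E ≃L[ℝ] E) : E →L[ℝ] E) p := by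
      have := hψp.hasStrictFDerivAt one_ne_zero
      rwa [hdp] at this
    have hleft := hs.eventually_left_inverse
    have hft : Tendsto f (𝓝 p) (𝓝 p) := by simpa only [hfp] using hfc.tendsto
    have hleft' := hft.eventually hleft
    change ∀ᶠ x in 𝓝 p, f x = id x
    filter_upwards [hleft, hleft', hVn] with x h1 h2 hx
    rw [hψinv x hx, h1] at h2
    exact h2.symm
  exact fun x hx => Filter.EventuallyEq.eq_of_nhds (hVW hx)


/-- For a `C^∞` diffeomorphism `λ` of a chart `U` onto an open
subset of another chart `V` (with smooth effective finite group actions),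
any group homomorphism `α : Γ → Δ` making `λ` equivariant is injective,
and there is at most one such homomorphism. -/
theorem chart_embedding_homomorphism_injective_unique
    (n : ℕ) (Γ Δ : Type*) [Group Γ] [Finite Γ] [Group Δ] [Finite Δ]
    (U V : Set (EuclideanSpace ℝ (Fin n)))
    (hUopen : IsOpen U) (hUconn : IsConnected U)
    (hVopen : IsOpen V) (hVconn : IsConnected V)
    (ρ : Γ → EuclideanSpace ℝ (Fin n) → EuclideanSpace ℝ (Fin n))
    (σ : Δ → EuclideanSpace ℝ (Fin n) → EuclideanSpace ℝ (Fin n))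
    -- `ρ` is a smooth effective action of `Γ` on `U`
    (hρmaps : ∀ γ : Γ, Set.MapsTo (ρ γ) U U)
    (hρsmooth : ∀ γ : Γ, ContDiffOn ℝ (⊤ : ℕ∞) (ρ γ) U)
    (hρone : ∀ u ∈ U, ρ 1 u = u)
    (hρmul : ∀ γ δ : Γ, ∀ u ∈ U, ρ (γ * δ) u = ρ γ (ρ δ u))
    (hρeff : ∀ γ : Γ, (∀ u ∈ U, ρ γ u = u) → γ = 1)
    -- `σ` is a smooth effective action of `Δ` on `V`
    (hσmaps : ∀ δ : Δ, Set.MapsTo (σ δ) V V)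
    (hσsmooth : ∀ δ : Δ, ContDiffOn ℝ (⊤ : ℕ∞) (σ δ) V)
    (hσone : ∀ v ∈ V, σ 1 v = v)
    (hσmul : ∀ δ δ' : Δ, ∀ v ∈ V, σ (δ * δ') v = σ δ (σ δ' v))
    (hσeff : ∀ δ : Δ, (∀ v ∈ V, σ δ v = v) → δ = 1)
    -- `lam : U → V` is a `C^∞` diffeomorphism onto an open subset of `V`
    (lam laminv : EuclideanSpace ℝ (Fin n) → EuclideanSpace ℝ (Fin n))
    (hlammaps : Set.MapsTo lam U V)
    (hlaminj : Set.InjOn lam U)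
    (hlamopen : IsOpen (lam '' U))
    (hlamsmooth : ContDiffOn ℝ (⊤ : ℕ∞) lam U)
    (hlaminvsmooth : ContDiffOn ℝ (⊤ : ℕ∞) laminv (lam '' U))
    (hlaminv : Set.InvOn laminv lam U (lam '' U)) :
    -- any equivariance homomorphism is injective ...
    (∀ α : Γ →* Δ,
      (∀ γ : Γ, ∀ u ∈ U, lam (ρ γ u) = σ (α γ) (lam u)) →
      Function.Injective α) ∧
    -- ... and there is at most one such homomorphism
    (∀ α α' : Γ →* Δ,
      (∀ γ : Γ, ∀ u ∈ U, lam (ρ γ u) = σ (α γ) (lam u)) →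
      (∀ γ : Γ, ∀ u ∈ U, lam (ρ γ u) = σ (α' γ) (lam u)) →
      α = α') := by
  have hσeq : ∀ δ : Δ, (∀ u ∈ U, σ δ (lam u) = lam u) → δ = 1 := by
    intro δ hδ
    obtain ⟨u₀, hu₀⟩ := hUconn.nonempty
    have hiter : ∀ k : ℕ, ∀ v ∈ V, (σ δ)^[k] v = σ (δ ^ k) v := by
      intro k
      induction k with
      | zero => intro v hv; simp [hσone v hv]
      | succ k ih =>
        intro v hv
        rw [Function.iterate_succ_apply, ih _ (hσmaps δ hv), pow_succ, hσmul _ _ v hv]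
    refine hσeff δ (hVconn.isPreconnected.eqOn_id_of_iterate_eqOn_id hVopen (hσmaps δ)
      ((hσsmooth δ).of_le (by exact_mod_cast le_top)) (orderOf_pos δ).ne' (fun v hv => ?_)
      (hlammaps hu₀) ?_)
    · rw [hiter _ v hv, pow_orderOf_eq_one, hσone v hv, id]
    · filter_upwards [hlamopen.mem_nhds (Set.mem_image_of_mem lam hu₀)]
      rintro _ ⟨u, hu, rfl⟩
      exact hδ u hu
  refine ⟨fun α hα => (injective_iff_map_eq_one α).mpr fun γ hγ => hρeff γ fun u hu => ?_,
    fun α α' hα hα' => MonoidHom.ext fun γ => ?_⟩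
  · refine hlaminj (hρmaps γ hu) hu ?_
    rw [hα γ u hu, hγ, hσone _ (hlammaps hu)]
  · refine (inv_mul_eq_one.mp (hσeq ((α' γ)⁻¹ * α γ) fun u hu => ?_)).symm
    rw [hσmul _ _ _ (hlammaps hu), ← hα γ u hu, hα' γ u hu, ← hσmul _ _ _ (hlammaps hu),
      inv_mul_cancel, hσone _ (hlammaps hu)]
end
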